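/- arXiv:1212.3633 — 2 statements merged into one kernel-verified Lean document; each statement's English description precedes it below -/
import Mathlib

section
/- Any pancyclic graph on n ≥ 3 vertices has at least n - 1 + log₂(n - 1) edges. -/
open SimpleGraph

namespace SimpleGraph

variable {V : Type*} [DecidableEq V] {G : SimpleGraph V}

/-- The mod 2 edge chain of a walk. -/
def Walk.modTwoChain {u v : V} (w : G.Walk u v) : G.edgeSet → ZMod 2 :=
  fun e => (w.edges.count (e : Sym2 V) : ZMod 2)

theorem Walk.modTwoChain_cons {u v x : V} (h : G.Adj u v) (w : G.Walk v x) :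
    (Walk.cons h w).modTwoChain =
      Pi.single (⟨s(u, v), h⟩ : G.edgeSet) 1 + w.modTwoChain := by
  funext e
  rcases e with ⟨e, he⟩
  by_cases heq : s(u, v) = e
  · subst heq
    simp [modTwoChain, add_comm]
  · have hne : (⟨e, he⟩ : G.edgeSet) ≠ ⟨s(u, v), h⟩ :=
      fun h1 => heq (congrArg Subtype.val h1).symm
    simp [modTwoChain, heq, Pi.single_eq_of_ne hne]

theorem Walk.IsCycle.preconnected_of_length_eq_card [Fintype V] {v : V}
    {w : G.Walk v v} (hw : w.IsCycle)
    (hl : w.length = Fintype.card V) : G.Preconnected := by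
  have hmem : ∀ x, x ∈ w.support := fun x => by
    have huniv : w.support.tail.toFinset = Finset.univ := by
      rw [← Finset.card_eq_iff_eq_univ, List.toFinset_card_of_nodup hw.support_nodup,
        List.length_tail, w.length_support, hl, Nat.add_sub_cancel]
    exact List.mem_of_mem_tail (List.mem_toFinset.mp (huniv ▸ Finset.mem_univ x))
  exact fun x y => (w.takeUntil x (hmem x)).reachable.symm.trans (w.takeUntil y (hmem y)).reachable

variable [Fintype V] [DecidableRel G.Adj]

variable (G) in
/-- The mod 2 boundary map, from edge chains to vertex chains. -/
def modTwoBoundary : (G.edgeSet → ZMod 2) →ₗ[ZMod 2] (V → ZMod 2) :=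
  Fintype.linearCombination (ZMod 2) fun e v => if v ∈ (e : Sym2 V) then 1 else 0

theorem modTwoBoundary_single {u v : V} (h : G.Adj u v) :
    G.modTwoBoundary (Pi.single (⟨s(u, v), h⟩ : G.edgeSet) 1) =
      Pi.single u 1 + Pi.single v 1 := by
  rw [modTwoBoundary, Fintype.linearCombination_apply_single]
  funext x
  have := h.ne
  simp only [one_smul, Sym2.mem_iff, Pi.add_apply, Pi.single_apply]
  grind

theorem Walk.modTwoBoundary_modTwoChain {u v : V} (w : G.Walk u v) :
    G.modTwoBoundary w.modTwoChain = Pi.single u 1 + Pi.single v 1 := by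
  induction w with
  | @nil x =>
    have h : (Walk.nil : G.Walk x x).modTwoChain = 0 := by
      funext e
      simp [modTwoChain]
    rw [h, map_zero, ZModModule.add_self]
  | cons h p ih =>
    rw [modTwoChain_cons, map_add, modTwoBoundary_single, ih, ZModModule.add_add_add_cancel]

theorem Walk.IsTrail.card_support_modTwoChain {u v : V} {w : G.Walk u v} (hw : w.IsTrail) :
    (Finset.univ.filter fun e => w.modTwoChain e ≠ 0).card = w.length := by
  rw [← w.length_edges, ← List.toFinset_card_of_nodup hw.edges_nodup,
    ← Finset.card_map (Function.Embedding.subtype _)]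
  congr 1
  ext e
  simp only [Finset.mem_map, Finset.mem_filter, Finset.mem_univ, true_and,
    Function.Embedding.subtype_apply, List.mem_toFinset]
  constructor
  · rintro ⟨f, hf, rfl⟩
    by_contra hmem
    exact hf (by simp [modTwoChain, List.count_eq_zero_of_not_mem hmem])
  · intro he
    refine ⟨⟨e, w.edges_subset_edgeSet he⟩, ?_, rfl⟩
    simp [modTwoChain, List.count_eq_one_of_mem hw.edges_nodup he]

theorem Preconnected.card_le_finrank_range_modTwoBoundary (hG : G.Preconnected) :
    Fintype.card V ≤ Module.finrank (ZMod 2) (LinearMap.range G.modTwoBoundary) + 1 := by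
  rcases isEmpty_or_nonempty V with h | ⟨⟨r⟩⟩
  · simp
  have htop : LinearMap.range G.modTwoBoundary ⊔
      Submodule.span (ZMod 2) {(Pi.single r 1 : V → ZMod 2)} = ⊤ := by
    rw [eq_top_iff, ← (Pi.basisFun (ZMod 2) V).span_eq, Submodule.span_le]
    rintro _ ⟨v, rfl⟩
    obtain ⟨w⟩ := hG v r
    have hv : (Pi.basisFun (ZMod 2) V) v =
        G.modTwoBoundary w.modTwoChain + Pi.single r 1 := by
      rw [w.modTwoBoundary_modTwoChain, add_assoc, ZModModule.add_self, add_zero,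
        Pi.basisFun_apply]
    rw [hv]
    exact Submodule.add_mem_sup (LinearMap.mem_range_self _ _) (Submodule.mem_span_singleton_self _)
  have hr : (Pi.single r 1 : V → ZMod 2) ≠ 0 := by simp
  have hadd := Submodule.finrank_add_le_finrank_add_finrank (LinearMap.range G.modTwoBoundary)
    (Submodule.span (ZMod 2) {(Pi.single r 1 : V → ZMod 2)})
  rw [htop, finrank_top, Module.finrank_fintype_fun_eq_card] at hadd
  exact hadd.trans (Nat.add_le_add_left (finrank_span_singleton hr).le _)

theorem Preconnected.finrank_ker_modTwoBoundary_add_card_le (hG : G.Preconnected) :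
    Module.finrank (ZMod 2) (LinearMap.ker G.modTwoBoundary) + Fintype.card V ≤
      G.edgeFinset.card + 1 := by
  have hrank := LinearMap.finrank_range_add_finrank_ker G.modTwoBoundary
  rw [Module.finrank_fintype_fun_eq_card, ← edgeFinset_card] at hrank
  have := hG.card_le_finrank_range_modTwoBoundary
  omega

/-- The number of distinct cycle lengths is less than the size of the mod 2 cycle space. -/
theorem card_cycle_lengths_lt (s : Finset ℕ)
    (hs : ∀ l ∈ s, ∃ (v : V) (w : G.Walk v v), w.IsCycle ∧ w.length = l) :
    s.card < 2 ^ Module.finrank (ZMod 2) (LinearMap.ker G.modTwoBoundary) := by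
  classical
  have hpos : 0 ∉ s := fun h => by
    obtain ⟨v, w, hw, hl⟩ := hs 0 h
    have := hw.three_le_length
    omega
  have hsub : insert 0 s ⊆ Finset.univ.image
      fun x : LinearMap.ker G.modTwoBoundary => (Finset.univ.filter fun e => x.1 e ≠ 0).card := by
    intro l hl
    rw [Finset.mem_image]
    rcases Finset.mem_insert.mp hl with rfl | hl
    · exact ⟨0, Finset.mem_univ _, by simp⟩
    · obtain ⟨v, w, hw, rfl⟩ := hs l hl
      refine ⟨⟨w.modTwoChain, ?_⟩, Finset.mem_univ _, hw.isTrail.card_support_modTwoChain⟩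
      rw [LinearMap.mem_ker, w.modTwoBoundary_modTwoChain, ZModModule.add_self]
  have hcard := (Finset.card_le_card hsub).trans Finset.card_image_le
  rw [Finset.card_insert_of_notMem hpos, Finset.card_univ,
    Module.card_eq_pow_finrank (K := ZMod 2), ZMod.card] at hcard
  exact hcard

end SimpleGraph

/-- A pancyclic graph on `n ≥ 3` vertices has at least `n - 1 + log₂ (n - 1)`
edges. -/
theorem stmt_2 {V : Type*} [Fintype V] [DecidableEq V] (G : SimpleGraph V)
    [DecidableRel G.Adj] (n : ℕ) (hn : 3 ≤ n) (hcard : Fintype.card V = n)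
    (hpan : ∀ l : ℕ, 3 ≤ l → l ≤ n →
      ∃ (v : V) (w : G.Walk v v), w.IsCycle ∧ w.length = l) :
    (n : ℝ) - 1 + Real.logb 2 (n - 1) ≤ G.edgeFinset.card := by
  obtain ⟨v, w, hw, hl⟩ := hpan n hn le_rfl
  have hrank :=
    (hw.preconnected_of_length_eq_card (hl.trans hcard.symm)).finrank_ker_modTwoBoundary_add_card_le
  have hlt := card_cycle_lengths_lt (G := G) (Finset.Icc 3 n) fun l h =>
    hpan l (Finset.mem_Icc.mp h).1 (Finset.mem_Icc.mp h).2
  rw [hcard] at hrank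
  rw [Nat.card_Icc] at hlt
  set k := Module.finrank (ZMod 2) (LinearMap.ker G.modTwoBoundary)
  have hpow : (n : ℝ) - 1 ≤ 2 ^ (k : ℝ) := by
    rw [Real.rpow_natCast, sub_le_iff_le_add]
    exact_mod_cast (by omega : n ≤ 2 ^ k + 1)
  have hn' : (3 : ℝ) ≤ n := by exact_mod_cast hn
  have hlog : Real.logb 2 (n - 1) ≤ k :=
    (Real.logb_le_iff_le_rpow one_lt_two (by linarith)).mpr hpow
  have hrank' : (k : ℝ) + n ≤ G.edgeFinset.card + 1 := by exact_mod_cast hrank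
  linarith
end

section
/- Adding chords e_1, ..., e_p one at a time to a convex embedding of C_n, the number n_i of new cycles created when e_i is added satisfies i + 1 ≤ n_i ≤ 2^i, where the lower bound holds with equality iff e_1,...,e_i are pairwise non-crossing and the upper bound iff e_i crosses every e_j with j < i (here the inequality, not the equality conditions, is to be proved). -/
open SimpleGraph

/-- `e` is a chord of the cycle graph `Cₙ`: an edge between two distinct,
non-adjacent vertices of the cycle. -/
def IsChord (n : ℕ) (e : Sym2 (Fin n)) : Prop :=
  ¬ e.IsDiag ∧ e ∉ (cycleGraph n).edgeSet

/-- The set of edge sets of cycles of a graph `G`; this identifies a cycle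
with its edge set, so that each cycle is counted exactly once. -/
def cycleEdgeSets {V : Type*} [DecidableEq V] (G : SimpleGraph V) : Set (Finset (Sym2 V)) :=
  {E | ∃ (v : V) (w : G.Walk v v), w.IsCycle ∧ w.edges.toFinset = E}

/-- Vertices `a` and `b` are joined in `G` by a path with all its vertices in `S` and with all
edges of `F` among its edges. -/
def PathIn {V : Type*} (G : SimpleGraph V) (a b : V) (S : Set V) (F : Set (Sym2 V)) : Prop :=
  ∃ w : G.Walk a b, w.IsPath ∧ (∀ z ∈ w.support, z ∈ S) ∧ ∀ f ∈ F, f ∈ w.edges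

namespace PathIn

variable {V : Type*} {G G' : SimpleGraph V} {a b c d : V} {S T : Set V} {F F' : Set (Sym2 V)}

theorem symm (h : PathIn G a b S F) : PathIn G b a S F := by
  obtain ⟨w, hw, hS, hF⟩ := h
  exact ⟨w.reverse, hw.reverse, by simpa using hS, by simpa using hF⟩

theorem mono (hG : G ≤ G') (h : PathIn G a b S F) : PathIn G' a b S F := by
  obtain ⟨w, hw, hS, hF⟩ := h
  exact ⟨w.mapLe hG, hw.mapLe hG, by simpa using hS, by simpa using hF⟩

theorem join (h₁ : PathIn G a c S F) (hcd : G.Adj c d) (h₂ : PathIn G d b T F')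
    (hST : ∀ z ∈ S, z ∉ T) : PathIn G a b (S ∪ T) (insert s(c, d) (F ∪ F')) := by
  obtain ⟨w₁, hw₁, hS, hF⟩ := h₁
  obtain ⟨w₂, hw₂, hT, hF'⟩ := h₂
  refine ⟨w₁.append (Walk.cons hcd w₂), ?_, ?_, ?_⟩
  · rw [Walk.isPath_def, Walk.support_append, Walk.support_cons, List.tail_cons,
      List.nodup_append]
    refine ⟨hw₁.support_nodup, hw₂.support_nodup, ?_⟩
    rintro x hx y hy rfl
    exact hST x (hS x hx) (hT x hy)
  · intro z hz
    rw [Walk.support_append, Walk.support_cons, List.tail_cons, List.mem_append] at hz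
    exact hz.imp (hS z) (hT z)
  · rintro f (rfl | hf | hf)
    · simp
    · simp [hF f hf]
    · simp [hF' f hf]

end PathIn

section Cycles

variable {V : Type*} [DecidableEq V] {G G' : SimpleGraph V}

theorem cycleEdgeSets_mono (hG : G ≤ G') : cycleEdgeSets G ⊆ cycleEdgeSets G' := by
  rintro E ⟨v, w, hw, rfl⟩
  exact ⟨v, w.mapLe hG, hw.mapLe hG, by simp⟩

theorem mem_edgeSet_of_mem_cycleEdgeSets {E : Finset (Sym2 V)} (hE : E ∈ cycleEdgeSets G)
    {f : Sym2 V} (hf : f ∈ E) : f ∈ G.edgeSet := by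
  obtain ⟨v, w, -, rfl⟩ := hE
  exact w.edges_subset_edgeSet (List.mem_toFinset.mp hf)

theorem even_card_filter_of_mem_cycleEdgeSets {E : Finset (Sym2 V)} (hE : E ∈ cycleEdgeSets G)
    (v : V) : Even (E.filter (v ∈ ·)).card := by
  obtain ⟨u, w, hw, rfl⟩ := hE
  have h := (hw.isTrail.even_countP_edges_iff v).2 (by simp)
  rw [List.countP_eq_length_filter] at h
  rw [← List.toFinset_card_of_nodup (hw.isTrail.edges_nodup.filter _), List.toFinset_filter] at h
  simpa using h

theorem insert_edges_mem_cycleEdgeSets (hG : G ≤ G') {a b : V} (hab : G'.Adj a b)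
    (hab' : s(a, b) ∉ G.edgeSet) (w : G.Walk a b) (hw : w.IsPath) :
    insert s(a, b) w.edges.toFinset ∈ cycleEdgeSets G' := by
  refine ⟨b, Walk.cons hab.symm (w.mapLe hG), ?_, ?_⟩
  · rw [Walk.cons_isCycle_iff]
    refine ⟨hw.mapLe hG, fun h => hab' ?_⟩
    rw [Walk.edges_mapLe_eq_edges, Sym2.eq_swap] at h
    exact w.edges_subset_edgeSet h
  · simp [Sym2.eq_swap]

theorem PathIn.exists_mem_cycleEdgeSets {a b : V} {S : Set V} {F : Set (Sym2 V)}
    (h : PathIn G a b S F) (hG : G ≤ G') (hab : G'.Adj a b) (hab' : s(a, b) ∉ G.edgeSet) :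
    ∃ E ∈ cycleEdgeSets G', s(a, b) ∈ E ∧ (∀ f ∈ F, f ∈ E) ∧
      ∀ f ∈ E, f = s(a, b) ∨ ∀ z ∈ f, z ∈ S := by
  obtain ⟨w, hw, hS, hF⟩ := h
  refine ⟨_, insert_edges_mem_cycleEdgeSets hG hab hab' w hw, by simp, fun f hf => ?_,
    fun f hf => ?_⟩
  · simp [hF f hf]
  · rw [Finset.mem_insert, List.mem_toFinset] at hf
    refine hf.imp_right fun hf z hz => hS z ?_
    exact w.mem_support_of_mem_edges hf hz

end Cycles

section CycleGraph

variable {n : ℕ}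

theorem cycleGraph_adj_of_val_succ {u v : Fin n} (h : u.val + 1 = v.val) :
    (cycleGraph n).Adj u v := by
  rw [cycleGraph_adj']
  right
  rw [Fin.sub_val_of_le (Fin.le_def.2 (by lia))]
  lia

theorem cycleGraph_adj_of_endpoints (hn : 3 ≤ n) {u v : Fin n} (hu : u.val = 0)
    (hv : v.val + 1 = n) : (cycleGraph n).Adj u v := by
  rw [cycleGraph_adj']
  left
  rw [Fin.coe_sub_iff_lt.mpr (Fin.lt_def.2 (by lia))]
  lia

theorem pathIn_cycleGraph_Icc {x y : Fin n} (h : x ≤ y) :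
    PathIn (cycleGraph n) x y (Set.Icc x y) ∅ := by
  obtain ⟨k, hk⟩ : ∃ k, x.val + k = y.val := ⟨y.val - x.val, by rw [Fin.le_def] at h; lia⟩
  induction k generalizing y with
  | zero =>
    obtain rfl : x = y := Fin.ext hk
    exact ⟨Walk.nil, by simp, by simp, by simp⟩
  | succ k ih =>
    let y' : Fin n := ⟨x.val + k, by lia⟩
    have hy' : x ≤ y' := Fin.le_def.2 (by simp [y'])
    have hadj : (cycleGraph n).Adj y' y := cycleGraph_adj_of_val_succ (by simp [y']; lia)
    obtain ⟨w, hw, hS, -⟩ := (ih hy' rfl).join hadj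
      (⟨Walk.nil, by simp, by simp, by simp⟩ : PathIn (cycleGraph n) y y {y} ∅) (by
        rintro z ⟨-, hz⟩ rfl
        simp only [Fin.le_def, y'] at hz
        lia)
    refine ⟨w, hw, fun z hz => ?_, by simp⟩
    rcases hS z hz with hz | rfl
    · exact ⟨hz.1, hz.2.trans (Fin.le_def.2 (by simp [y']; lia))⟩
    · exact ⟨h, le_rfl⟩

theorem pathIn_cycleGraph_compl (hn : 3 ≤ n) {x y : Fin n} (h : x < y) :
    PathIn (cycleGraph n) x y (Set.Iic x ∪ Set.Ici y) {s(⟨0, by lia⟩, ⟨n - 1, by lia⟩)} := by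
  have h₀ : (⟨0, by lia⟩ : Fin n) ≤ x := Fin.le_def.2 (by simp)
  have h₁ : y ≤ (⟨n - 1, by lia⟩ : Fin n) := Fin.le_def.2 (by simp; lia)
  obtain ⟨w, hw, hS, hF⟩ := (pathIn_cycleGraph_Icc h₀).symm.join
    (cycleGraph_adj_of_endpoints hn rfl (by simp; lia)) (pathIn_cycleGraph_Icc h₁).symm
    (fun z hz hz' => absurd (hz'.1.trans hz.2) h.not_ge)
  exact ⟨w, hw, fun z hz => (hS z hz).imp (·.2) (·.1), fun f hf => hF f (Or.inl hf)⟩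

theorem exists_eq_mk_lt {e : Sym2 (Fin n)} (he : ¬ e.IsDiag) : ∃ a b, a < b ∧ e = s(a, b) := by
  induction e with
  | _ a b =>
    rcases lt_trichotomy a b with h | h | h
    · exact ⟨a, b, h, rfl⟩
    · exact absurd h he
    · exact ⟨b, a, h, Sym2.eq_swap⟩

theorem exists_cycle_mem_mem_of_le (hn : 3 ≤ n) {a b c d : Fin n} (hab : a < b) (hcd : c < d)
    (he : s(a, b) ∉ (cycleGraph n).edgeSet)
    (hne : s(a, b) ≠ s(c, d)) (hac : a ≤ c) :
    ∃ E ∈ cycleEdgeSets (cycleGraph n ⊔ fromEdgeSet {s(a, b), s(c, d)}),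
      s(a, b) ∈ E ∧ s(c, d) ∈ E := by
  set G := cycleGraph n ⊔ fromEdgeSet {s(c, d)} with hG
  have hGcd : G.Adj c d := Or.inr ((fromEdgeSet_adj _).2 ⟨rfl, hcd.ne⟩)
  have hle : cycleGraph n ≤ G := le_sup_left
  suffices h : ∃ S F, PathIn G a b S F ∧ s(c, d) ∈ F by
    obtain ⟨S, F, h, hF⟩ := h
    obtain ⟨E, hE, h₁, h₂, -⟩ := h.exists_mem_cycleEdgeSets
      (G' := cycleGraph n ⊔ fromEdgeSet {s(a, b), s(c, d)})
      (sup_le_sup_left (fromEdgeSet_mono (by simp)) _)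
      (Or.inr ((fromEdgeSet_adj _).2 ⟨Or.inl rfl, hab.ne⟩))
      (by
        rw [hG, edgeSet_sup, edgeSet_fromEdgeSet]
        rintro (h | h)
        · exact he h
        · exact hne h.1)
    exact ⟨E, hE, h₁, h₂ _ hF⟩
  rcases le_or_gt d b with hdb | hbd
  · exact ⟨_, _, ((pathIn_cycleGraph_Icc hac).mono hle).join hGcd
      ((pathIn_cycleGraph_Icc hdb).mono hle)
      (fun z hz hz' => absurd (hz'.1.trans hz.2) hcd.not_ge), Or.inl rfl⟩
  rcases le_or_gt b c with hbc | hcb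
  · have h := (pathIn_cycleGraph_compl hn (hab.trans (hbc.trans_lt hcd))).mono hle
    exact ⟨_, _, h.join hGcd.symm
      ((pathIn_cycleGraph_Icc hbc).symm.mono hle) (by
        rintro z (hz | hz) hz'
        · exact absurd (hz'.1.trans hz) hab.not_ge
        · exact absurd (le_trans hz hz'.2) hcd.not_ge), Or.inl Sym2.eq_swap⟩
  · exact ⟨_, _, ((pathIn_cycleGraph_Icc hac).mono hle).join hGcd
      ((pathIn_cycleGraph_Icc hbd.le).symm.mono hle)
      (fun z hz hz' => absurd (hz'.1.trans hz.2) hcb.not_ge), Or.inl rfl⟩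

theorem exists_cycle_mem_mem (hn : 3 ≤ n) {e f : Sym2 (Fin n)} (he : IsChord n e)
    (hf : IsChord n f) (hne : e ≠ f) :
    ∃ E ∈ cycleEdgeSets (cycleGraph n ⊔ fromEdgeSet {e, f}), e ∈ E ∧ f ∈ E := by
  obtain ⟨a, b, hab, rfl⟩ := exists_eq_mk_lt he.1
  obtain ⟨c, d, hcd, rfl⟩ := exists_eq_mk_lt hf.1
  rcases le_total a c with hac | hca
  · exact exists_cycle_mem_mem_of_le hn hab hcd he.2 hne hac
  · obtain ⟨E, hE, h₁, h₂⟩ := exists_cycle_mem_mem_of_le hn hcd hab hf.2 hne.symm hca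
    rw [Set.pair_comm] at hE
    exact ⟨E, hE, h₂, h₁⟩

theorem exists_two_cycles_mem (hn : 3 ≤ n) {e : Sym2 (Fin n)} (he : IsChord n e) :
    ∃ E₁ ∈ cycleEdgeSets (cycleGraph n ⊔ fromEdgeSet {e}),
      ∃ E₂ ∈ cycleEdgeSets (cycleGraph n ⊔ fromEdgeSet {e}), e ∈ E₁ ∧ e ∈ E₂ ∧ E₁ ≠ E₂ := by
  obtain ⟨a, b, hab, rfl⟩ := exists_eq_mk_lt he.1
  have hadj : (cycleGraph n ⊔ fromEdgeSet {s(a, b)}).Adj a b :=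
    Or.inr ((fromEdgeSet_adj _).2 ⟨rfl, hab.ne⟩)
  obtain ⟨E₁, hE₁, h₁, -, hS⟩ :=
    (pathIn_cycleGraph_Icc hab.le).exists_mem_cycleEdgeSets le_sup_left hadj he.2
  obtain ⟨E₂, hE₂, h₂, hF, -⟩ :=
    (pathIn_cycleGraph_compl hn hab).exists_mem_cycleEdgeSets le_sup_left hadj he.2
  refine ⟨E₁, hE₁, E₂, hE₂, h₁, h₂, ?_⟩
  rintro rfl
  have hends : s((⟨0, by lia⟩ : Fin n), ⟨n - 1, by lia⟩) ∈ (cycleGraph n).edgeSet :=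
    cycleGraph_adj_of_endpoints hn rfl (by simp; lia)
  rcases hS _ (hF _ rfl) with h | h
  · exact he.2 (h ▸ hends)
  · have h₀ := (h _ (Sym2.mem_mk_left _ _)).1
    have h₁ := (h _ (Sym2.mem_mk_right _ _)).2
    refine he.2 (cycleGraph_adj_of_endpoints hn ?_ ?_)
    · simpa [Fin.le_def] using h₀
    · simp only [Fin.le_def] at h₁
      lia

end CycleGraph

section UpperBound

variable {m : ℕ}

theorem mem_edgeSet_cycleGraph_and_mem_iff (v : Fin (m + 3)) (f : Sym2 (Fin (m + 3))) :
    f ∈ (cycleGraph (m + 3)).edgeSet ∧ v ∈ f ↔ f = s(v, v + 1) ∨ f = s(v - 1, v) := by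
  constructor
  · rintro ⟨hf, hv⟩
    obtain ⟨u, rfl⟩ := hv
    have : u ∈ (cycleGraph (m + 3)).neighborSet v := hf
    rw [cycleGraph_neighborSet] at this
    rcases this with rfl | rfl
    · exact Or.inr Sym2.eq_swap
    · exact Or.inl rfl
  · rintro (rfl | rfl)
    · simp [cycleGraph_adj]
    · simp [cycleGraph_adj]

theorem mk_succ_ne_mk_pred (v : Fin (m + 3)) : s(v, v + 1) ≠ s(v - 1, v) := by
  intro h
  rw [Sym2.eq_swap, Sym2.congr_left] at h
  have h2 : (1 + 1 : Fin (m + 3)) = 0 := by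
    rw [eq_sub_iff_add_eq, add_assoc, add_eq_left] at h
    exact h
  have := congrArg Fin.val h2
  simp only [Fin.val_add, Fin.val_one, Fin.val_zero] at this
  rw [Nat.mod_eq_of_lt (by lia)] at this
  lia

open Classical in
theorem card_filter_mem_eq (E : Finset (Sym2 (Fin (m + 3)))) (v : Fin (m + 3)) :
    (E.filter (v ∈ ·)).card =
      (E.filter (fun f => f ∉ (cycleGraph (m + 3)).edgeSet ∧ v ∈ f)).card +
        ((if s(v, v + 1) ∈ E then 1 else 0) + if s(v - 1, v) ∈ E then 1 else 0) := by
  rw [← Finset.card_filter_add_card_filter_not (s := E.filter (v ∈ ·))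
    (fun f => f ∉ (cycleGraph (m + 3)).edgeSet)]
  congr 1
  · rw [Finset.filter_filter]
    simp only [and_comm]
  · have : (E.filter (v ∈ ·)).filter (fun f => ¬ f ∉ (cycleGraph (m + 3)).edgeSet) =
        ({s(v, v + 1), s(v - 1, v)} : Finset _).filter (· ∈ E) := by
      ext f
      have := mem_edgeSet_cycleGraph_and_mem_iff v f
      simp only [Finset.mem_filter, Finset.mem_insert, Finset.mem_singleton]
      tauto
    rw [this, Finset.card_filter, Finset.sum_pair (mk_succ_ne_mk_pred v)]

theorem eq_of_even_of_forall_chord_mem_iff {E E' : Finset (Sym2 (Fin (m + 3)))}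
    (hE : ∀ v, Even (E.filter (v ∈ ·)).card) (hE' : ∀ v, Even (E'.filter (v ∈ ·)).card)
    (hchord : ∀ f ∉ (cycleGraph (m + 3)).edgeSet, f ∈ E ↔ f ∈ E')
    (h₀ : s(0, 1) ∈ E ↔ s(0, 1) ∈ E') : E = E' := by
  classical
  have step (v) (h : s(v - 1, v) ∈ E ↔ s(v - 1, v) ∈ E') :
      s(v, v + 1) ∈ E ↔ s(v, v + 1) ∈ E' := by
    have h₁ := hE v
    have h₂ := hE' v
    rw [card_filter_mem_eq] at h₁ h₂
    have : E.filter (fun f => f ∉ (cycleGraph (m + 3)).edgeSet ∧ v ∈ f) =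
        E'.filter (fun f => f ∉ (cycleGraph (m + 3)).edgeSet ∧ v ∈ f) := by
      ext f
      have := hchord f
      simp only [Finset.mem_filter]
      tauto
    rw [this] at h₁
    grind
  have all (v : Fin (m + 3)) : s(v, v + 1) ∈ E ↔ s(v, v + 1) ∈ E' := by
    induction v using Fin.induction with
    | zero => simpa using h₀
    | succ k ih =>
      refine step _ ?_
      simpa [← Fin.coeSucc_eq_succ] using ih
  ext f
  by_cases hf : f ∈ (cycleGraph (m + 3)).edgeSet
  · induction f with
    | _ u v =>
      have key := (mem_edgeSet_cycleGraph_and_mem_iff u s(u, v)).1 ⟨hf, by simp⟩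
      rcases key with h | h
      · rw [h]
        simpa using all u
      · rw [h]
        simpa using all (u - 1)
  · exact hchord f hf

theorem ncard_cycles_mem_le {e : Sym2 (Fin (m + 3))} {C : Finset (Sym2 (Fin (m + 3)))} :
    {E ∈ cycleEdgeSets (cycleGraph (m + 3) ⊔ fromEdgeSet (insert e ↑C)) | e ∈ E}.ncard ≤
      2 ^ (C.card + 1) := by
  classical
  have hcard : ((C.powerset ×ˢ (Finset.univ : Finset Bool) : Finset _) :
      Set (Finset (Sym2 (Fin (m + 3))) × Bool)).ncard = 2 ^ (C.card + 1) := by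
    rw [Set.ncard_coe_finset, Finset.card_product, Finset.card_powerset, pow_succ]
    simp
  rw [← hcard]
  refine Set.ncard_le_ncard_of_injOn (fun E => (E ∩ C, decide (s(0, 1) ∈ E))) ?_ ?_
    (Finset.finite_toSet _)
  · intro E _
    simp [em]
  · rintro E ⟨hE, heE⟩ E' ⟨hE', heE'⟩ h
    simp only [Prod.mk.injEq, decide_eq_decide] at h
    refine eq_of_even_of_forall_chord_mem_iff (even_card_filter_of_mem_cycleEdgeSets hE)
      (even_card_filter_of_mem_cycleEdgeSets hE') (fun f hf => ?_) h.2
    by_cases hfe : f = e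
    · simp [hfe, heE, heE']
    by_cases hfC : f ∈ C
    · have := Finset.ext_iff.1 h.1 f
      simpa [hfC] using this
    · have hnot : f ∉ (cycleGraph (m + 3) ⊔ fromEdgeSet (insert e ↑C)).edgeSet := by
        rw [edgeSet_sup, edgeSet_fromEdgeSet]
        rintro (h | ⟨h | h, -⟩)
        · exact hf h
        · exact hfe h
        · exact hfC h
      exact iff_of_false (fun h => hnot (mem_edgeSet_of_mem_cycleEdgeSets hE h))
        (fun h => hnot (mem_edgeSet_of_mem_cycleEdgeSets hE' h))

end UpperBound

theorem card_add_two_le_ncard_cycles_mem {n : ℕ} (hn : 3 ≤ n) {e : Sym2 (Fin n)}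
    {C : Finset (Sym2 (Fin n))} (he : IsChord n e) (hC : ∀ f ∈ C, IsChord n f) (heC : e ∉ C) :
    C.card + 2 ≤
      {E ∈ cycleEdgeSets (cycleGraph n ⊔ fromEdgeSet (insert e ↑C)) | e ∈ E}.ncard := by
  classical
  obtain ⟨E₁, hE₁, E₂, hE₂, he₁, he₂, hne⟩ := exists_two_cycles_mem hn he
  have hex (f : C) := exists_cycle_mem_mem hn he (hC f f.2) (fun h => heC (h ▸ f.2))
  choose g hg heg hfg using hex
  have hg' (f f' : C) (h : f.1 ∈ g f') : f = f' := by
    have := mem_edgeSet_of_mem_cycleEdgeSets (hg f') h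
    rw [edgeSet_sup, edgeSet_fromEdgeSet] at this
    rcases this with h | ⟨h | h, -⟩
    · exact absurd h (hC f f.2).2
    · exact absurd (h ▸ f.2) heC
    · exact Subtype.ext h
  have hnot {E} (hE : E ∈ cycleEdgeSets (cycleGraph n ⊔ fromEdgeSet {e})) (f : C) : E ≠ g f := by
    rintro rfl
    have := mem_edgeSet_of_mem_cycleEdgeSets hE (hfg f)
    rw [edgeSet_sup, edgeSet_fromEdgeSet] at this
    rcases this with h | ⟨h, -⟩
    · exact (hC f f.2).2 h
    · exact heC (h ▸ f.2)
  have hinj : Function.Injective g := fun f f' h => hg' f f' (h ▸ hfg f)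
  have hcard : (insert E₁ (insert E₂ (Finset.univ.image g))).card = C.card + 2 := by
    rw [Finset.card_insert_of_notMem, Finset.card_insert_of_notMem,
      Finset.card_image_of_injective _ hinj]
    · simp
    · simpa using fun a ha h => hnot hE₂ ⟨a, ha⟩ h.symm
    · simpa [hne] using fun a ha h => hnot hE₁ ⟨a, ha⟩ h.symm
  rw [← hcard, ← Set.ncard_coe_finset]
  refine Set.ncard_le_ncard ?_ (Set.toFinite _)
  have hle {F : Set (Sym2 (Fin n))} (hF : F ⊆ insert e ↑C) :
      cycleGraph n ⊔ fromEdgeSet F ≤ cycleGraph n ⊔ fromEdgeSet (insert e ↑C) :=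
    sup_le_sup_left (fromEdgeSet_mono hF) _
  intro E hE
  simp only [Finset.coe_insert, Finset.coe_image, Finset.coe_univ, Set.image_univ] at hE
  rcases hE with rfl | rfl | ⟨f, rfl⟩
  · exact ⟨cycleEdgeSets_mono (hle (by simp)) hE₁, he₁⟩
  · exact ⟨cycleEdgeSets_mono (hle (by simp)) hE₂, he₂⟩
  · refine ⟨cycleEdgeSets_mono (hle ?_) (hg f), heg f⟩
    rintro x (rfl | rfl)
    · exact Or.inl rfl
    · exact Or.inr f.2

/-- Adding chords `e 1, …, e p` one at a time to `Cₙ`, the number `nᵢ` of new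
cycles created when `e i` is added (that is, cycles in the graph with the
first `i` chords whose edge set contains `e i`) satisfies
`i + 1 ≤ nᵢ ≤ 2 ^ i`. -/
theorem stmt_15 (n p : ℕ) (hn : 3 ≤ n) (e : ℕ → Sym2 (Fin n))
    (hchords : ∀ i, 1 ≤ i → i ≤ p → IsChord n (e i))
    (hinj : ∀ i j, 1 ≤ i → i ≤ p → 1 ≤ j → j ≤ p → e i = e j → i = j)
    (i : ℕ) (hi1 : 1 ≤ i) (hip : i ≤ p) :
    i + 1 ≤ {E ∈ cycleEdgeSets
        (cycleGraph n ⊔ fromEdgeSet ↑((Finset.Icc 1 i).image e)) |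
        e i ∈ E}.ncard ∧
      {E ∈ cycleEdgeSets
        (cycleGraph n ⊔ fromEdgeSet ↑((Finset.Icc 1 i).image e)) |
        e i ∈ E}.ncard ≤ 2 ^ i := by
  set C := (Finset.Icc 1 (i - 1)).image e with hCdef
  have hset : ((Finset.Icc 1 i).image e : Set (Sym2 (Fin n))) = insert (e i) (C : Set _) := by
    rw [← Finset.coe_insert, hCdef, ← Finset.image_insert]
    congr 2
    ext k
    simp only [Finset.mem_Icc, Finset.mem_insert]
    lia
  have hcard : C.card = i - 1 := by
    rw [hCdef, Finset.card_image_of_injOn, Nat.card_Icc]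
    · lia
    · intro j hj k hk h
      simp only [Finset.coe_Icc, Set.mem_Icc] at hj hk
      exact hinj j k hj.1 (by lia) hk.1 (by lia) h
  have hC : ∀ f ∈ C, IsChord n f := by
    simp only [hCdef, Finset.mem_image, Finset.mem_Icc]
    rintro _ ⟨j, hj, rfl⟩
    exact hchords j hj.1 (by lia)
  have heC : e i ∉ C := by
    simp only [hCdef, Finset.mem_image, Finset.mem_Icc]
    rintro ⟨j, hj, h⟩
    have := hinj j i hj.1 (by lia) hi1 hip h
    lia
  rw [hset]
  constructor
  · have := card_add_two_le_ncard_cycles_mem hn (hchords i hi1 hip) hC heC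
    lia
  · obtain ⟨m, rfl⟩ := Nat.exists_eq_add_of_le' hn
    have := ncard_cycles_mem_le (e := e i) (C := C)
    rwa [hcard, Nat.sub_add_cancel hi1] at this
end
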